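/- For every n ≥ 1, every valuation v ∈ F_{C_n}, and every formula α, the value v(α^n) belongs to {T_n, F_n}; i.e., under the restricted valuations the formula α^n (the n-th consistency operator applied to α) always receives a classical truth-value. -/

import Mathlib

/-- Formulas of the language of da Costa's calculi `Cₙ`. -/
inductive CnForm : Type where
  | atom : ℕ → CnForm
  | neg : CnForm → CnForm
  | conj : CnForm → CnForm → CnForm
  | disj : CnForm → CnForm → CnForm
  | imp : CnForm → CnForm → CnForm
deriving DecidableEq

/-- Truth values of the Nmatrix `M_{Cₙ}`: `Tv` is `Tₙ`, `tv i` is `tᵢⁿ`, `Fv` is `Fₙ`. -/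
inductive CnVal (n : ℕ) : Type where
  | Tv : CnVal n
  | tv : Fin n → CnVal n
  | Fv : CnVal n
deriving DecidableEq

/-- Multifunction for negation. -/
def CnNeg {n : ℕ} : CnVal n → Set (CnVal n)
  | CnVal.Tv => {CnVal.Fv}
  | CnVal.tv _ => {x | x ≠ CnVal.Fv}
  | CnVal.Fv => {CnVal.Tv}

/-- Multifunction for conjunction. -/
def CnConj {n : ℕ} (x y : CnVal n) : Set (CnVal n) :=
  if x = CnVal.Fv ∨ y = CnVal.Fv then {CnVal.Fv}
  else if x = CnVal.Tv ∧ y = CnVal.Tv then {CnVal.Tv}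
  else {z | z ≠ CnVal.Fv}

/-- Multifunction for disjunction. -/
def CnDisj {n : ℕ} (x y : CnVal n) : Set (CnVal n) :=
  if x = CnVal.Fv ∧ y = CnVal.Fv then {CnVal.Fv}
  else if (x = CnVal.Tv ∨ x = CnVal.Fv) ∧ (y = CnVal.Tv ∨ y = CnVal.Fv) ∧
          (x = CnVal.Tv ∨ y = CnVal.Tv) then {CnVal.Tv}
  else {z | z ≠ CnVal.Fv}

/-- Multifunction for implication. -/
def CnImp {n : ℕ} (x y : CnVal n) : Set (CnVal n) :=
  if x ≠ CnVal.Fv ∧ y = CnVal.Fv then {CnVal.Fv}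
  else if (x = CnVal.Fv ∧ (y = CnVal.Tv ∨ y = CnVal.Fv)) ∨ (x = CnVal.Tv ∧ y = CnVal.Tv)
    then {CnVal.Tv}
  else {z | z ≠ CnVal.Fv}

/-- `v ∈ Val(M_{Cₙ})`: `v` is a valuation of the Nmatrix `M_{Cₙ}`. -/
def CnIsVal {n : ℕ} (v : CnForm → CnVal n) : Prop :=
  (∀ a, v (CnForm.neg a) ∈ CnNeg (v a)) ∧
  (∀ a b, v (CnForm.conj a b) ∈ CnConj (v a) (v b)) ∧
  (∀ a b, v (CnForm.disj a b) ∈ CnDisj (v a) (v b)) ∧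
  (∀ a b, v (CnForm.imp a b) ∈ CnImp (v a) (v b))

/-- `a.pow k` is `αᵏ`: `α⁰ = α`, `α^{k+1} = ¬(αᵏ ∧ ¬αᵏ)`. -/
def CnForm.pow (a : CnForm) : ℕ → CnForm
  | 0 => a
  | k + 1 => CnForm.neg (CnForm.conj (a.pow k) (CnForm.neg (a.pow k)))

/-- `v ∈ F_{Cₙ}`: a valuation satisfying the restriction of the RNmatrix for `Cₙ`. -/
def CnRestricted {n : ℕ} (v : CnForm → CnVal n) : Prop :=
  CnIsVal v ∧
  ∀ (a : CnForm) (i : Fin n), v a = CnVal.tv i →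
    (i.val = 0 → v (CnForm.conj a (CnForm.neg a)) = CnVal.Tv) ∧
    (∀ j : Fin n, i.val = j.val + 1 →
      (∃ m : Fin n, v (CnForm.conj a (CnForm.neg a)) = CnVal.tv m) ∧
      v (a.pow 1) = CnVal.tv j)

/-- Tautology of the RNmatrix `R(M_{Cₙ}) = ⟨F_{Cₙ}, M_{Cₙ}⟩`. -/
def CnTaut (n : ℕ) (φ : CnForm) : Prop :=
  ∀ v : CnForm → CnVal n, CnRestricted v → v φ ≠ CnVal.Fv

theorem CnRestricted.pow_one_of_classical {n : ℕ} {v : CnForm → CnVal n} (hv : CnRestricted v)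
    {a : CnForm} (ha : v a = CnVal.Tv ∨ v a = CnVal.Fv) : v (a.pow 1) = CnVal.Tv := by
  obtain ⟨⟨hneg, hconj, -, -⟩, -⟩ := hv
  have hbot : v (CnForm.conj a (CnForm.neg a)) = CnVal.Fv := by
    have h₁ := hneg a
    have h₂ := hconj a (CnForm.neg a)
    rcases ha with h | h <;> simp_all [CnNeg, CnConj]
  have h := hneg (CnForm.conj a (CnForm.neg a))
  rw [hbot] at h
  exact h

theorem CnRestricted.pow_one_of_tv_zero {n : ℕ} {v : CnForm → CnVal n} (hv : CnRestricted v)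
    {a : CnForm} {i : Fin n} (ha : v a = CnVal.tv i) (hi : i.val = 0) :
    v (a.pow 1) = CnVal.Fv := by
  have h := hv.1.1 (CnForm.conj a (CnForm.neg a))
  rw [(hv.2 a i ha).1 hi] at h
  exact h

/-- Each application of the consistency operator lowers the index of an inconsistent value. -/
theorem CnRestricted.pow_classical_or_tv {n : ℕ} {v : CnForm → CnVal n} (hv : CnRestricted v)
    (a : CnForm) (k : ℕ) :
    (v (a.pow k) = CnVal.Tv ∨ v (a.pow k) = CnVal.Fv) ∨
      ∃ i : Fin n, v (a.pow k) = CnVal.tv i ∧ i.val + k < n := by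
  induction k with
  | zero =>
    cases h : v (a.pow 0) with
    | Tv => simp
    | Fv => simp
    | tv i => exact Or.inr ⟨i, rfl, i.isLt⟩
  | succ k ih =>
    change (v ((a.pow k).pow 1) = _ ∨ v ((a.pow k).pow 1) = _) ∨
      ∃ i : Fin n, v ((a.pow k).pow 1) = CnVal.tv i ∧ i.val + (k + 1) < n
    rcases ih with h | ⟨i, h, hi⟩
    · exact Or.inl (Or.inl (hv.pow_one_of_classical h))
    · rcases Nat.eq_zero_or_pos i.val with h0 | hpos
      · exact Or.inl (Or.inr (hv.pow_one_of_tv_zero h h0))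
      · let j : Fin n := ⟨i.val - 1, by omega⟩
        have hj : i.val = j.val + 1 := (Nat.sub_add_cancel hpos).symm
        exact Or.inr ⟨j, ((hv.2 _ i h).2 j hj).2, by omega⟩

theorem pow_n_is_classical (n : ℕ) (hn : 1 ≤ n)
    (v : CnForm → CnVal n) (hv : CnRestricted v) (a : CnForm) :
    v (a.pow n) = CnVal.Tv ∨ v (a.pow n) = CnVal.Fv := by
  rcases hv.pow_classical_or_tv a n with h | ⟨i, -, hi⟩
  · exact h
  · omega
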